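/- Let p be a prime, B a commutative ring of characteristic p, M a B-module, A = TrivSqZeroExt B M the trivial square-zero extension (so A is a commutative ring of characteristic p), and I = {(0, m) : m ∈ M} its square-zero ideal. Then the first-projection ring homomorphism A → B, applied coefficientwise to sequences, defines a group homomorphism π^{ev} : G_p(A,I) → G_p(B,{0}) which is a left inverse of the group homomorphism G_p(B,{0}) → G_p(A,I) induced coefficientwise by the inclusion B → A; the kernel of π^{ev} is G_p^od(A,I) = {α ∈ G_p(A,I) : α_i ∈ I for all i ≥ 1}. Consequently, G_p(A,I) is the internal semidirect product of the normal subgroup G_p^od(A,I) and the image of G_p(B,{0}). -/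

import Mathlib

/-- The product of two coefficient sequences, encoding substitution of the power series
`∑_{j≥0} α_j X^(p^j)` into `∑_{i≥0} β_i X^(p^i)`:
`(α·β)_i = ∑_{j=0}^{i} (α_{i−j})^(p^j) · β_j`. -/
def seqMul {A : Type*} [CommRing A] (p : ℕ) (α β : ℕ → A) : ℕ → A :=
  fun i => ∑ j ∈ Finset.range (i + 1), α (i - j) ^ p ^ j * β j

/-- The identity sequence `δ`, with `δ_0 = 1` and `δ_i = 0` for `i ≥ 1`. -/
def seqOne {A : Type*} [CommRing A] : ℕ → A :=
  fun i => if i = 0 then 1 else 0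

/-- `I` is a square-zero ideal: `x·y = 0` for all `x, y ∈ I`. -/
def IsSqZero {A : Type*} [CommRing A] (I : Ideal A) : Prop :=
  ∀ x ∈ I, ∀ y ∈ I, x * y = 0

/-- The Steenrod group `G_p(A,I)`: sequences `α : ℕ → A` with `α 0 - 1 ∈ I`. -/
def steenrodSet {A : Type*} [CommRing A] (I : Ideal A) : Set (ℕ → A) :=
  {α | α 0 - 1 ∈ I}

/-- The odd part `G_p^od(A,I)`: elements of `G_p(A,I)` with `α_i ∈ I` for all `i ≥ 1`. -/
def steenrodOddSet {A : Type*} [CommRing A] (I : Ideal A) : Set (ℕ → A) :=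
  {α | α 0 - 1 ∈ I ∧ ∀ i : ℕ, 1 ≤ i → α i ∈ I}

theorem map_seqMul {A B : Type*} [CommRing A] [CommRing B] (f : A →+* B) (p : ℕ) (α β : ℕ → A) :
    (fun i => f (seqMul p α β i)) = seqMul p (fun i => f (α i)) (fun i => f (β i)) := by
  funext i
  simp [seqMul]

theorem seqMul_seqOne {A : Type*} [CommRing A] (p : ℕ) (α : ℕ → A) :
    seqMul p α seqOne = α := by
  funext i
  simp [seqMul, seqOne]

theorem seqOne_seqMul {A : Type*} [CommRing A] {p : ℕ} (hp : p ≠ 0) (β : ℕ → A) :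
    seqMul p seqOne β = β := by
  funext i
  rw [seqMul, Finset.sum_eq_single_of_mem i (by simp)]
  · simp [seqOne]
  · intro j hj hji
    have h : i - j ≠ 0 := by
      have := Finset.mem_range.mp hj
      omega
    simp [seqOne, h, hp]

theorem map_eq_seqOne_iff {A B : Type*} [CommRing A] [CommRing B] (f : A →+* B) (α : ℕ → A) :
    (fun i => f (α i)) = seqOne ↔ α ∈ steenrodOddSet (RingHom.ker f) := by
  simp only [steenrodOddSet, Set.mem_ofPred_eq, RingHom.mem_ker, map_sub, map_one, sub_eq_zero]
  refine ⟨fun h => ⟨by simpa [seqOne] using congrFun h 0, fun i hi => ?_⟩, fun h => ?_⟩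
  · simpa [seqOne, Nat.one_le_iff_ne_zero.mp hi] using congrFun h i
  · funext i
    by_cases hi : i = 0
    · simp [hi, h.1, seqOne]
    · simp [hi, h.2 i (Nat.one_le_iff_ne_zero.mpr hi), seqOne]

theorem map_mem_steenrodSet_bot {A B : Type*} [CommRing A] [CommRing B] (f : A →+* B)
    {α : ℕ → A} (hα : α ∈ steenrodSet (RingHom.ker f)) :
    (fun i => f (α i)) ∈ steenrodSet (⊥ : Ideal B) := by
  simpa [steenrodSet, RingHom.mem_ker] using hα

theorem mem_steenrodSet_bot_iff {A : Type*} [CommRing A] {α : ℕ → A} :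
    α ∈ steenrodSet (⊥ : Ideal A) ↔ α 0 = 1 := by
  simp [steenrodSet, sub_eq_zero]

theorem IsSqZero.pow_eq_zero {A : Type*} [CommRing A] {I : Ideal A} (hI : IsSqZero I) {x : A}
    (hx : x ∈ I) {n : ℕ} (hn : 2 ≤ n) : x ^ n = 0 :=
  pow_eq_zero_of_le hn (by rw [pow_two, hI x hx x hx])

/-- Frobenius powers of an odd element are those of the identity sequence. -/
theorem IsSqZero.pow_eq_seqOne {A : Type*} [CommRing A] {p : ℕ} [Fact p.Prime] [CharP A p]
    {I : Ideal A} (hI : IsSqZero I) {ν : ℕ → A} (hν : ν ∈ steenrodOddSet I) {j : ℕ}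
    (hj : j ≠ 0) (k : ℕ) : ν k ^ p ^ j = seqOne k := by
  have hpj : 2 ≤ p ^ j := (Fact.out : p.Prime).two_le.trans (Nat.le_self_pow hj p)
  rcases Nat.eq_zero_or_pos k with rfl | hk
  · have h := hI.pow_eq_zero hν.1 hpj
    rw [sub_pow_char_pow, one_pow, sub_eq_zero] at h
    simpa [seqOne] using h
  · simpa [seqOne, hk.ne'] using hI.pow_eq_zero (hν.2 k hk) hpj

/-- Left multiplication by an odd element only affects the terms linear in it. -/
theorem IsSqZero.odd_seqMul {A : Type*} [CommRing A] {p : ℕ} [Fact p.Prime] [CharP A p]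
    {I : Ideal A} (hI : IsSqZero I) {ν η : ℕ → A} (hν : ν ∈ steenrodOddSet I)
    (hη : η 0 = 1) (i : ℕ) : seqMul p ν η i = ν i + η i - seqOne i := by
  have hone := congrFun (seqOne_seqMul (Fact.out : p.Prime).ne_zero η) i
  rw [seqMul, Finset.sum_range_succ'] at hone ⊢
  simp only [hI.pow_eq_seqOne hν (Nat.succ_ne_zero _)]
  simp only [hη, pow_zero, pow_one, mul_one, Nat.sub_zero] at hone ⊢
  have hpow : ∀ j k : ℕ, (seqOne k : A) ^ p ^ j = seqOne k := by
    intro j k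
    by_cases hk : k = 0 <;> simp [seqOne, hk, (Fact.out : p.Prime).ne_zero]
  simp only [hpow] at hone
  linear_combination hone

theorem TrivSqZeroExt.isSqZero_ker_fstHom {B M : Type*} [CommRing B] [AddCommGroup M] [Module B M]
    [Module Bᵐᵒᵖ M] [IsCentralScalar B M] :
    IsSqZero (RingHom.ker (TrivSqZeroExt.fstHom B B M).toRingHom) := by
  intro x hx y hy
  have hx' : x.fst = 0 := hx
  have hy' : y.fst = 0 := hy
  ext <;> simp [hx', hy']

/-- Let `p` be a prime, `B` a commutative ring of characteristic
`p`, `M` a `B`-module, `A = TrivSqZeroExt B M` and `I = {(0, m) : m ∈ M}` (the kernel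
of the first projection), a square-zero ideal of `A`.  Then the first projection,
applied coefficientwise, is a group homomorphism `π^{ev} : G_p(A,I) → G_p(B,{0})`
which is a left inverse of the coefficientwise inclusion `G_p(B,{0}) → G_p(A,I)`; the
kernel of `π^{ev}` is `G_p^od(A,I)`, which is normal, and `G_p(A,I)` is the internal
semidirect product of `G_p^od(A,I)` with the image of `G_p(B,{0})`. -/
theorem steenrod_semidirect (p : ℕ) (hp : p.Prime) {B : Type*} [CommRing B] [CharP B p]
    {M : Type*} [AddCommGroup M] [Module B M] [Module Bᵐᵒᵖ M] [IsCentralScalar B M] :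
    CharP (TrivSqZeroExt B M) p ∧
    IsSqZero (RingHom.ker ((TrivSqZeroExt.fstHom B B M).toRingHom)) ∧
    -- `π^{ev}` maps `G_p(A,I)` to `G_p(B,{0})` and is multiplicative
    (∀ α ∈ steenrodSet (RingHom.ker ((TrivSqZeroExt.fstHom B B M).toRingHom)),
      (fun i => (α i).fst) ∈ steenrodSet (⊥ : Ideal B)) ∧
    (∀ α β : ℕ → TrivSqZeroExt B M,
      (fun i => (seqMul p α β i).fst)
        = seqMul p (fun i => (α i).fst) (fun i => (β i).fst)) ∧
    -- the coefficientwise inclusion maps `G_p(B,{0})` to `G_p(A,I)`, is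
    -- multiplicative, and `π^{ev}` is a left inverse of it
    (∀ a ∈ steenrodSet (⊥ : Ideal B),
      (fun i => (TrivSqZeroExt.inl (a i) : TrivSqZeroExt B M))
        ∈ steenrodSet (RingHom.ker ((TrivSqZeroExt.fstHom B B M).toRingHom))) ∧
    (∀ a b : ℕ → B,
      (fun i => (TrivSqZeroExt.inl (seqMul p a b i) : TrivSqZeroExt B M))
        = seqMul p (fun i => (TrivSqZeroExt.inl (a i) : TrivSqZeroExt B M))
            (fun i => (TrivSqZeroExt.inl (b i) : TrivSqZeroExt B M))) ∧
    (∀ a : ℕ → B,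
      (fun i => (TrivSqZeroExt.inl (a i) : TrivSqZeroExt B M).fst) = a) ∧
    -- the kernel of `π^{ev}` in `G_p(A,I)` is `G_p^od(A,I)`
    (∀ α ∈ steenrodSet (RingHom.ker ((TrivSqZeroExt.fstHom B B M).toRingHom)),
      ((fun i => (α i).fst) = seqOne (A := B) ↔
        α ∈ steenrodOddSet (RingHom.ker ((TrivSqZeroExt.fstHom B B M).toRingHom)))) ∧
    -- `G_p^od(A,I)` is normal in `G_p(A,I)`
    (∀ α ∈ steenrodOddSet (RingHom.ker ((TrivSqZeroExt.fstHom B B M).toRingHom)),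
      ∀ g ∈ steenrodSet (RingHom.ker ((TrivSqZeroExt.fstHom B B M).toRingHom)),
        ∀ g' : ℕ → TrivSqZeroExt B M,
          seqMul p g g' = seqOne → seqMul p g' g = seqOne →
            seqMul p (seqMul p g' α) g
              ∈ steenrodOddSet (RingHom.ker ((TrivSqZeroExt.fstHom B B M).toRingHom))) ∧
    -- internal semidirect product: unique decomposition `α = n · h`
    (∀ α ∈ steenrodSet (RingHom.ker ((TrivSqZeroExt.fstHom B B M).toRingHom)),
      ∃! nh : (ℕ → TrivSqZeroExt B M) × (ℕ → TrivSqZeroExt B M),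
        nh.1 ∈ steenrodOddSet (RingHom.ker ((TrivSqZeroExt.fstHom B B M).toRingHom)) ∧
        (∃ b : ℕ → B, b ∈ steenrodSet (⊥ : Ideal B) ∧
          nh.2 = fun i => (TrivSqZeroExt.inl (b i) : TrivSqZeroExt B M)) ∧
        α = seqMul p nh.1 nh.2) := by
  have : Fact p.Prime := ⟨hp⟩
  let π : TrivSqZeroExt B M →+* B := (TrivSqZeroExt.fstHom B B M).toRingHom
  let ι : B →+* TrivSqZeroExt B M := TrivSqZeroExt.inlHom B M
  have hchar : CharP (TrivSqZeroExt B M) p :=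
    charP_of_injective_ringHom (f := ι) TrivSqZeroExt.inl_injective p
  have hI : IsSqZero (RingHom.ker π) := TrivSqZeroExt.isSqZero_ker_fstHom
  refine ⟨hchar, hI, fun α hα => map_mem_steenrodSet_bot π hα, map_seqMul π p, ?_,
    map_seqMul ι p, fun a => rfl, fun α _ => map_eq_seqOne_iff π α, ?_, ?_⟩
  · intro a ha
    rw [mem_steenrodSet_bot_iff] at ha
    simp [steenrodSet, ha]
  · intro α hα g _ g' _ hg
    refine (map_eq_seqOne_iff π _).mp ?_
    rw [map_seqMul, map_seqMul, (map_eq_seqOne_iff π α).mpr hα, seqMul_seqOne, ← map_seqMul, hg]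
    funext i
    simp [seqOne, apply_ite π]
  · intro α hα
    have hb := map_mem_steenrodSet_bot π hα
    have hb0 : π (α 0) = 1 := mem_steenrodSet_bot_iff.mp hb
    have hν : (fun i => α i - ι (π (α i)) + seqOne i) ∈ steenrodOddSet (RingHom.ker π) := by
      refine (map_eq_seqOne_iff π _).mp ?_
      funext i
      have h : π (ι (π (α i))) = π (α i) := rfl
      simp [h, seqOne, apply_ite π]
    refine ⟨(fun i => α i - ι (π (α i)) + seqOne i, fun i => ι (π (α i))),
      ⟨hν, ⟨fun i => π (α i), hb, rfl⟩, ?_⟩, ?_⟩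
    · funext i
      rw [hI.odd_seqMul hν (by simp [hb0])]
      ring
    · rintro ⟨ν, η⟩ ⟨hν', ⟨b, hb', hη⟩, hmul⟩
      dsimp only at hν' hη hmul
      subst hη
      have hbα : (fun i => π (α i)) = b := by
        rw [hmul, map_seqMul, (map_eq_seqOne_iff π ν).mpr hν', seqOne_seqMul hp.ne_zero]
        rfl
      have hη0 : (TrivSqZeroExt.inl (b 0) : TrivSqZeroExt B M) = 1 := by
        rw [mem_steenrodSet_bot_iff.mp hb', TrivSqZeroExt.inl_one]
      have hη : ∀ i, ι (π (α i)) = TrivSqZeroExt.inl (b i) :=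
        fun i => congrArg ι (congrFun hbα i)
      refine Prod.ext (funext fun i => ?_) (funext fun i => (hη i).symm)
      have h := congrFun hmul i
      rw [hI.odd_seqMul hν' hη0] at h
      dsimp only
      rw [hη, h]
      ring
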